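/- arXiv:1601.02085 — 3 statements merged into one kernel-verified Lean document; each statement's English description precedes it below -/
import Mathlib

section
/- For all real numbers y and z, the series ∑_{α=1}^∞ |ψ_α(y) − ψ_α(z)|² / λ_α, i.e. ∑_{α=1}^∞ 2(cos(απy) − cos(απz))² / (απ)², converges and is bounded above by (8/π)|y − z|. -/
open Real

theorem hasSum_one_sub_cos_div_sq {x : ℝ} (hx : x ∈ Set.Icc (0 : ℝ) 1) :
    HasSum (fun n : ℕ => (1 - cos (2 * π * n * x)) / (n : ℝ) ^ 2) (π ^ 2 * (x - x ^ 2)) := by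
  have h := hasSum_zeta_two.sub (hasSum_one_div_nat_pow_mul_cos one_ne_zero hx)
  convert! h using 1
  · ext n
    ring
  · rw [mul_one, Polynomial.bernoulli]
    simp [Finset.sum_range_succ, bernoulli_one, bernoulli_two, Nat.factorial]
    ring

theorem cos_sub_cos_sq_le (a b : ℝ) : (cos a - cos b) ^ 2 ≤ 2 * (1 - cos (a - b)) := by
  have h : cos (a - b) = 1 - 2 * sin ((a - b) / 2) ^ 2 := by
    rw [← cos_sq_add_sin_sq ((a - b) / 2), ← mul_div_cancel₀ (a - b) (two_ne_zero (α := ℝ)),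
      cos_two_mul']
    ring_nf
  rw [cos_sub_cos]
  have h1 := sin_sq_le_one ((a + b) / 2)
  nlinarith [mul_le_mul_of_nonneg_right h1 (sq_nonneg (sin ((a - b) / 2)))]

/-- The Neumann cosine series is dominated termwise by a series with sum at most `2 * |y - z|`. -/
theorem exists_hasSum_majorant (y z : ℝ) :
    ∃ (g : ℕ → ℝ) (s : ℝ), HasSum g s ∧ s ≤ 2 * |y - z| ∧ g 0 = 0 ∧
      ∀ n : ℕ, 2 * (cos (n * π * y) - cos (n * π * z)) ^ 2 / (n * π) ^ 2 ≤ g n := by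
  have key : ∀ n : ℕ, 2 * (cos (n * π * y) - cos (n * π * z)) ^ 2 / (n * π) ^ 2 ≤
      4 / π ^ 2 * ((1 - cos (2 * π * n * (|y - z| / 2))) / (n : ℝ) ^ 2) := fun n => by
    have hc : cos (2 * π * n * (|y - z| / 2)) = cos (n * π * y - n * π * z) := by
      rw [← cos_abs (n * π * y - n * π * z), ← mul_sub, abs_mul,
        abs_of_nonneg (by positivity : 0 ≤ n * π)]
      ring_nf
    rw [hc, div_mul_div_comm, mul_comm (π ^ 2), ← mul_pow]
    refine div_le_div_of_nonneg_right ?_ (by positivity)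
    linarith [cos_sub_cos_sq_le (n * π * y) (n * π * z)]
  rcases le_total |y - z| 2 with hd | hd
  · have hx : |y - z| / 2 ∈ Set.Icc (0 : ℝ) 1 := ⟨by positivity, by linarith⟩
    refine ⟨_, _, (hasSum_one_sub_cos_div_sq hx).mul_left (4 / π ^ 2), ?_, by simp, key⟩
    rw [← mul_assoc, div_mul_cancel₀ _ (by positivity)]
    nlinarith [sq_nonneg |y - z|]
  · refine ⟨_, _, hasSum_zeta_two.mul_left (8 / π ^ 2), ?_, by simp, fun n => (key n).trans ?_⟩
    · have : 8 / π ^ 2 * (π ^ 2 / 6) = 4 / 3 := by field_simp; norm_num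
      linarith
    · have h : 8 / π ^ 2 * (1 / (n : ℝ) ^ 2) = 4 / π ^ 2 * (2 / (n : ℝ) ^ 2) := by ring
      rw [h]
      gcongr
      linarith [neg_one_le_cos (2 * π * n * (|y - z| / 2))]

theorem stmt_1 (y z : ℝ) :
    Summable (fun α : ℕ+ =>
      2 * (Real.cos ((α : ℝ) * Real.pi * y) - Real.cos ((α : ℝ) * Real.pi * z)) ^ 2
        / ((α : ℝ) * Real.pi) ^ 2) ∧
    ∑' α : ℕ+,
      2 * (Real.cos ((α : ℝ) * Real.pi * y) - Real.cos ((α : ℝ) * Real.pi * z)) ^ 2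
        / ((α : ℝ) * Real.pi) ^ 2 ≤ (8 / Real.pi) * |y - z| := by
  obtain ⟨g, s, hg, hs, hg0, hle⟩ := exists_hasSum_majorant y z
  have hg' : HasSum (fun α : ℕ+ => g α) s := by
    refine (PNat.coe_injective.hasSum_iff fun n hn => ?_).mpr hg
    rcases Nat.eq_zero_or_pos n with rfl | hn'
    · exact hg0
    · exact absurd ⟨⟨n, hn'⟩, rfl⟩ hn
  have hsum : Summable (fun α : ℕ+ =>
      2 * (cos ((α : ℝ) * π * y) - cos ((α : ℝ) * π * z)) ^ 2 / ((α : ℝ) * π) ^ 2) :=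
    Summable.of_nonneg_of_le (fun α => by positivity) (fun α => hle α) hg'.summable
  refine ⟨hsum, (hasSum_le (fun α : ℕ+ => hle α) hsum.hasSum hg').trans (hs.trans ?_)⟩
  gcongr
  rw [le_div_iff₀ pi_pos]
  linarith [pi_le_four]
end

section
/- For every κ with 1/2 < κ < 3/2 there exists a constant C = C(κ) > 0 such that for all real numbers y and z, ∑_{α=1}^∞ |φ_α(y) − φ_α(z)|² / λ_α^κ, i.e. ∑_{α=1}^∞ 2(sin(απy) − sin(απz))² / (απ)^{2κ}, converges and is at most C|y − z|^{2κ−1}. -/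
open Real

/-- Discrete derivative bound for a positive power. -/
lemma min_mul_rpow_le_rpow_sub_rpow {p x : ℝ} (hp : 0 < p) (hx : 0 ≤ x) :
    min 1 p * (x + 1) ^ (p - 1) ≤ (x + 1) ^ p - x ^ p := by
  have hx1 : 0 < x + 1 := by linarith
  have hu0 : 0 ≤ x / (x + 1) := by positivity
  have hu : x / (x + 1) = 1 + -(1 / (x + 1)) := by field_simp; ring
  have hinv : 0 < 1 / (x + 1) := by positivity
  have key : (x / (x + 1)) ^ p ≤ 1 - min 1 p * (1 / (x + 1)) := by
    rcases le_total 1 p with h | h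
    · rw [min_eq_left h]
      calc (x / (x + 1)) ^ p ≤ (x / (x + 1)) ^ (1 : ℝ) :=
            rpow_le_rpow_of_exponent_ge' hu0 (by rw [hu]; linarith) zero_le_one h
        _ = 1 - 1 * (1 / (x + 1)) := by rw [rpow_one, hu]; ring
    · rw [min_eq_right h, hu]
      have := rpow_one_add_le_one_add_mul_self (s := -(1 / (x + 1))) (p := p)
        (by linarith) hp.le h
      linarith
  rw [div_rpow hx hx1.le, div_le_iff₀ (by positivity)] at key
  have hpow : (x + 1) ^ (p - 1) = 1 / (x + 1) * (x + 1) ^ p := by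
    rw [rpow_sub_one hx1.ne']; ring
  rw [hpow]
  linarith

/-- Discrete derivative bound for a negative power. -/
lemma mul_rpow_neg_le_rpow_neg_sub_rpow_neg {q x : ℝ} (hq : 0 < q) (hx : 0 < x) :
    q * (x + 1) ^ (-q - 1) ≤ x ^ (-q) - (x + 1) ^ (-q) := by
  have hx1 : 0 < x + 1 := by linarith
  have hu0 : 0 < x / (x + 1) := by positivity
  have hu : x / (x + 1) - 1 = -(1 / (x + 1)) := by field_simp; ring
  have key : 1 + q * (1 / (x + 1)) ≤ (x / (x + 1)) ^ (-q) := by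
    rw [rpow_def_of_pos hu0]
    have h1 := add_one_le_exp (log (x / (x + 1)) * -q)
    have h2 := log_le_sub_one_of_pos hu0
    rw [hu] at h2
    nlinarith
  rw [div_rpow hx.le hx1.le, le_div_iff₀ (by positivity)] at key
  have hpow : (x + 1) ^ (-q - 1) = 1 / (x + 1) * (x + 1) ^ (-q) := by
    rw [rpow_sub_one hx1.ne']; ring
  rw [hpow]
  linarith

lemma sum_range_rpow_sub_one_le {p : ℝ} (hp : 0 < p) (N : ℕ) :
    min 1 p * ∑ i ∈ Finset.range N, ((i : ℝ) + 1) ^ (p - 1) ≤ (N : ℝ) ^ p := by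
  induction N with
  | zero => simp [hp.ne']
  | succ n ih =>
    rw [Finset.sum_range_succ, mul_add, Nat.cast_succ]
    have := min_mul_rpow_le_rpow_sub_rpow hp (Nat.cast_nonneg n)
    linarith

lemma sum_Ico_rpow_neg_le {q : ℝ} (hq : 0 < q) {M : ℕ} (hM : 0 < M) (N : ℕ) :
    q * ∑ i ∈ Finset.Ico M N, ((i : ℝ) + 1) ^ (-q - 1) ≤ (M : ℝ) ^ (-q) := by
  rcases le_total N M with h | h
  · rw [Finset.Ico_eq_empty_of_le h]
    simp only [Finset.sum_empty, mul_zero]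
    positivity
  suffices H : q * ∑ i ∈ Finset.Ico M N, ((i : ℝ) + 1) ^ (-q - 1)
      ≤ (M : ℝ) ^ (-q) - (N : ℝ) ^ (-q) by
    have : 0 ≤ (N : ℝ) ^ (-q) := by positivity
    linarith
  induction N, h using Nat.le_induction with
  | base => simp
  | succ n hn ih =>
    rw [Finset.sum_Ico_succ_top hn, mul_add, Nat.cast_succ]
    have := mul_rpow_neg_le_rpow_neg_sub_rpow_neg (x := (n : ℝ)) hq
      (by exact_mod_cast hM.trans_le hn)
    linarith

/-- Partial sums of `min(4, (n h)²) / n^s`, `1 < s < 3`, are of order `h^(s - 1)`. -/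
lemma exists_sum_min_sq_mul_rpow_neg_le {s : ℝ} (hs₁ : 1 < s) (hs₃ : s < 3) :
    ∃ C : ℝ, 0 < C ∧ ∀ h : ℝ, 0 < h → ∀ N : ℕ,
      ∑ i ∈ Finset.range N, min 4 ((((i : ℝ) + 1) * h) ^ 2) * ((i : ℝ) + 1) ^ (-s)
        ≤ C * h ^ (s - 1) := by
  have hq : 0 < s - 1 := by linarith
  have hp : 0 < 3 - s := by linarith
  have hc : 0 < min 1 (3 - s) := lt_min one_pos hp
  refine ⟨4 + 1 / min 1 (3 - s) + 4 / (s - 1) * 2 ^ (s - 1), by positivity, fun h hh N => ?_⟩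
  set f : ℕ → ℝ := fun i => min 4 ((((i : ℝ) + 1) * h) ^ 2) * ((i : ℝ) + 1) ^ (-s) with hf
  have hf0 : ∀ i, 0 ≤ f i := fun i => by positivity
  have htail : ∀ M : ℕ, 0 < M →
      ∑ i ∈ Finset.Ico M N, f i ≤ 4 / (s - 1) * (M : ℝ) ^ (-(s - 1)) := by
    intro M hM
    have h1 := sum_Ico_rpow_neg_le hq hM N
    rw [show -(s - 1) - 1 = -s by ring] at h1
    calc ∑ i ∈ Finset.Ico M N, f i
        ≤ ∑ i ∈ Finset.Ico M N, 4 * ((i : ℝ) + 1) ^ (-s) :=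
          Finset.sum_le_sum fun i _ =>
            mul_le_mul_of_nonneg_right (min_le_left _ _) (by positivity)
      _ = 4 / (s - 1) * ((s - 1) * ∑ i ∈ Finset.Ico M N, ((i : ℝ) + 1) ^ (-s)) := by
          rw [← Finset.mul_sum]; field_simp
      _ ≤ _ := by gcongr
  have hhead : ∀ M : ℕ,
      ∑ i ∈ Finset.range M, f i ≤ 1 / min 1 (3 - s) * (h ^ 2 * (M : ℝ) ^ (3 - s)) := by
    intro M
    have h1 := sum_range_rpow_sub_one_le hp M
    calc ∑ i ∈ Finset.range M, f i
        ≤ ∑ i ∈ Finset.range M, h ^ 2 * ((i : ℝ) + 1) ^ (3 - s - 1) := by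
          refine Finset.sum_le_sum fun i _ =>
            (mul_le_mul_of_nonneg_right (min_le_right _ _) (by positivity)).trans_eq ?_
          rw [show 3 - s - 1 = (2 : ℕ) + -s by push_cast; ring, rpow_add (by positivity),
            rpow_natCast]
          ring
      _ = 1 / min 1 (3 - s) *
            (h ^ 2 * (min 1 (3 - s) * ∑ i ∈ Finset.range M, ((i : ℝ) + 1) ^ (3 - s - 1))) := by
          rw [← Finset.mul_sum]; field_simp
      _ ≤ _ := by gcongr
  have hsplit : ∀ M : ℕ, ∑ i ∈ Finset.range N, f i
      ≤ ∑ i ∈ Finset.range M, f i + ∑ i ∈ Finset.Ico M N, f i := by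
    intro M
    rcases le_total M N with hMN | hMN
    · exact (Finset.sum_range_add_sum_Ico f hMN).ge
    · rw [Finset.Ico_eq_empty_of_le hMN, Finset.sum_empty, add_zero]
      exact Finset.sum_le_sum_of_subset_of_nonneg (Finset.range_mono hMN) fun i _ _ => hf0 i
  have hhq : 0 < h ^ (s - 1) := by positivity
  have h2q : 1 ≤ (2 : ℝ) ^ (s - 1) := one_le_rpow one_le_two hq.le
  rcases le_total 1 h with h1 | h1
  · have h3 := htail 1 one_pos
    have h4 : ∑ i ∈ Finset.range 1, f i ≤ 4 := by simp [hf]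
    have h5 : 1 ≤ h ^ (s - 1) := one_le_rpow h1 hq.le
    rw [Nat.cast_one, one_rpow] at h3
    calc ∑ i ∈ Finset.range N, f i ≤ 4 + 0 + 4 / (s - 1) * 1 := by linarith [hsplit 1]
      _ ≤ 4 + 1 / min 1 (3 - s) + 4 / (s - 1) * 2 ^ (s - 1) := by gcongr; positivity
      _ ≤ _ := le_mul_of_one_le_right (by positivity) h5
  · set M := ⌊1 / h⌋₊
    have hM : 0 < M := Nat.floor_pos.2 ((one_le_div hh).2 h1)
    have hM1 : (1 : ℝ) ≤ M := by exact_mod_cast hM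
    have hMle : (M : ℝ) ≤ h⁻¹ := by
      rw [← one_div]; exact Nat.floor_le (by positivity)
    have hMge : (2 * h)⁻¹ ≤ M := by
      have := Nat.lt_floor_add_one (1 / h)
      rw [mul_inv, ← one_div h]
      linarith
    have e1 : h ^ 2 * (M : ℝ) ^ (3 - s) ≤ h ^ (s - 1) := by
      calc h ^ 2 * (M : ℝ) ^ (3 - s) ≤ h ^ 2 * h⁻¹ ^ (3 - s) := by gcongr
        _ = h ^ (s - 1) := by
          rw [inv_rpow hh.le, ← rpow_neg hh.le, ← rpow_natCast, ← rpow_add hh]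
          congr 1; push_cast; ring
    have e2 : (M : ℝ) ^ (-(s - 1)) ≤ 2 ^ (s - 1) * h ^ (s - 1) := by
      calc (M : ℝ) ^ (-(s - 1)) ≤ (2 * h)⁻¹ ^ (-(s - 1)) :=
            rpow_le_rpow_of_nonpos (by positivity) hMge (by linarith)
        _ = 2 ^ (s - 1) * h ^ (s - 1) := by
          rw [inv_rpow (by positivity), rpow_neg (by positivity), inv_inv,
            mul_rpow zero_le_two hh.le]
    calc ∑ i ∈ Finset.range N, f i
        ≤ 1 / min 1 (3 - s) * (h ^ 2 * (M : ℝ) ^ (3 - s))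
            + 4 / (s - 1) * (M : ℝ) ^ (-(s - 1)) :=
          (hsplit M).trans (add_le_add (hhead M) (htail M hM))
      _ ≤ 1 / min 1 (3 - s) * h ^ (s - 1) + 4 / (s - 1) * (2 ^ (s - 1) * h ^ (s - 1)) := by
          gcongr
      _ ≤ _ := by linarith

lemma sq_sin_sub_sin_le (a b : ℝ) : (sin a - sin b) ^ 2 ≤ min 4 ((a - b) ^ 2) := by
  refine le_min ?_ (sq_le_sq.2 ?_)
  · nlinarith [neg_one_le_sin a, sin_le_one a, neg_one_le_sin b, sin_le_one b]
  · simpa [Real.dist_eq] using lipschitzWith_sin.dist_le_mul a b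

theorem stmt_2 (κ : ℝ) (hκ₁ : 1 / 2 < κ) (hκ₂ : κ < 3 / 2) :
    ∃ C : ℝ, 0 < C ∧ ∀ y z : ℝ,
      Summable (fun α : ℕ+ =>
        2 * (Real.sin ((α : ℝ) * Real.pi * y) - Real.sin ((α : ℝ) * Real.pi * z)) ^ 2
          / ((α : ℝ) * Real.pi) ^ (2 * κ)) ∧
      ∑' α : ℕ+,
        2 * (Real.sin ((α : ℝ) * Real.pi * y) - Real.sin ((α : ℝ) * Real.pi * z)) ^ 2
          / ((α : ℝ) * Real.pi) ^ (2 * κ) ≤ C * |y - z| ^ (2 * κ - 1) := by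
  have hs : 1 < 2 * κ := by linarith
  obtain ⟨C, hC, hbound⟩ := exists_sum_min_sq_mul_rpow_neg_le hs (by linarith : 2 * κ < 3)
  refine ⟨2 * (C * π ^ (2 * κ - 1)), by positivity, fun y z => ?_⟩
  rcases eq_or_ne y z with rfl | hyz
  · simp [summable_zero, zero_rpow (by linarith : 2 * κ - 1 ≠ 0)]
  have hh : 0 < π * |y - z| := mul_pos pi_pos (abs_pos.2 (sub_ne_zero.2 hyz))
  set g : ℕ → ℝ := fun n => 2 * (sin ((n : ℝ) * π * y) - sin ((n : ℝ) * π * z)) ^ 2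
    / ((n : ℝ) * π) ^ (2 * κ) with hg
  have hg0 : ∀ n, 0 ≤ g (n + 1) := fun n => by positivity
  have hterm : ∀ n : ℕ, g (n + 1) ≤
      2 * (min 4 ((((n : ℝ) + 1) * (π * |y - z|)) ^ 2) * ((n : ℝ) + 1) ^ (-(2 * κ))) := by
    intro n
    have h1 := sq_sin_sub_sin_le (((n : ℝ) + 1) * π * y) (((n : ℝ) + 1) * π * z)
    rw [show (((n : ℝ) + 1) * π * y - ((n : ℝ) + 1) * π * z) ^ 2
      = (((n : ℝ) + 1) * (π * |y - z|)) ^ 2 by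
        rw [mul_pow _ (π * _), mul_pow π, sq_abs]; ring] at h1
    have h2 : ((n : ℝ) + 1) ^ (2 * κ) ≤ (((n : ℝ) + 1) * π) ^ (2 * κ) := by
      gcongr
      exact le_mul_of_one_le_right (by positivity) (by linarith [pi_gt_three])
    simp only [hg, Nat.cast_succ]
    rw [rpow_neg (by positivity), ← div_eq_mul_inv, ← mul_div_assoc]
    gcongr
  have hpartial : ∀ N, ∑ i ∈ Finset.range N, g (i + 1)
      ≤ 2 * (C * π ^ (2 * κ - 1)) * |y - z| ^ (2 * κ - 1) := by
    intro N
    calc ∑ i ∈ Finset.range N, g (i + 1)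
        ≤ 2 * (C * (π * |y - z|) ^ (2 * κ - 1)) := by
          refine (Finset.sum_le_sum fun i _ => hterm i).trans ?_
          rw [← Finset.mul_sum]
          exact mul_le_mul_of_nonneg_left (hbound _ hh N) zero_le_two
      _ = _ := by rw [mul_rpow pi_pos.le (abs_nonneg _)]; ring
  refine ⟨(summable_pnat_iff_summable_succ (f := g)).2
    (summable_of_sum_range_le hg0 hpartial), ?_⟩
  rw [tsum_pnat_eq_tsum_succ (f := g)]
  exact Real.tsum_le_of_sum_range_le hg0 hpartial
end

section
/- For every T > 0 there exists a constant C = C(T) > 0 (one may take C = 8T/π) such that for every t ∈ [0,T] and all real numbers y and z, ∑_{α=1}^∞ |ψ_α(y) − ψ_α(z)|² · ∫₀ᵗ (sin(απ(t−s))/(απ))² ds, i.e. ∑_{α=1}^∞ 2(cos(απy) − cos(απz))² · ∫₀ᵗ sin²(απ(t−s))/(απ)² ds, converges and is bounded above by C|y − z|. -/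
open Real

theorem integral_sin_sq_div_sq_le (a t : ℝ) (ht : 0 ≤ t) :
    ∫ s in (0:ℝ)..t, sin (a * (t - s)) ^ 2 / a ^ 2 ≤ t / a ^ 2 := by
  have h : ∫ s in (0:ℝ)..t, sin (a * (t - s)) ^ 2 / a ^ 2 ≤ ∫ _s in (0:ℝ)..t, 1 / a ^ 2 := by
    apply intervalIntegral.integral_mono_on ht
    · exact Continuous.intervalIntegrable (by fun_prop) _ _
    · exact Continuous.intervalIntegrable (by fun_prop) _ _
    · intro s _
      gcongr
      exact sin_sq_le_one _
  rw [intervalIntegral.integral_const, smul_eq_mul, sub_zero, mul_one_div] at h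
  exact h

theorem integral_sin_sq_div_sq_nonneg (a t : ℝ) (ht : 0 ≤ t) :
    0 ≤ ∫ s in (0:ℝ)..t, sin (a * (t - s)) ^ 2 / a ^ 2 :=
  intervalIntegral.integral_nonneg ht fun _ _ => by positivity

/-- The mode-wise bound `min (h, 1 / n) ^ 2 ≤ 4 h ^ 2 / (1 + h n) ^ 2`, in telescoping form. -/
theorem sq_le_telescoping {m h : ℝ} (n : ℕ) (hm : 0 ≤ m) (hmh : m ≤ h)
    (hmn : m * ((n + 1 : ℕ) : ℝ) ≤ 1) :
    m ^ 2 ≤ 4 * (h / (1 + h * (n : ℝ)) - h / (1 + h * ((n + 1 : ℕ) : ℝ))) := by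
  have hh : 0 ≤ h := hm.trans hmh
  push_cast at hmn ⊢
  have hn : (0 : ℝ) ≤ n := n.cast_nonneg
  have hp : 0 < 1 + h * (n : ℝ) := by positivity
  have hq : 0 < 1 + h * ((n : ℝ) + 1) := by positivity
  have hle : m * (1 + h * ((n : ℝ) + 1)) ≤ 2 * h := by nlinarith
  have hsq : (m * (1 + h * ((n : ℝ) + 1))) ^ 2 ≤ (2 * h) ^ 2 := by gcongr
  have heq : h / (1 + h * (n : ℝ)) - h / (1 + h * ((n : ℝ) + 1)) =
      h ^ 2 / ((1 + h * (n : ℝ)) * (1 + h * ((n : ℝ) + 1))) := by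
    field_simp
    ring
  rw [heq, ← mul_div_assoc, le_div_iff₀ (by positivity)]
  have hpq : m ^ 2 * ((1 + h * (n : ℝ)) * (1 + h * ((n : ℝ) + 1))) ≤
      m ^ 2 * ((1 + h * ((n : ℝ) + 1)) * (1 + h * ((n : ℝ) + 1))) := by
    gcongr
    linarith
  nlinarith

theorem cos_sub_cos_sq_div_le (n : ℕ) (y z : ℝ) :
    (cos (((n + 1 : ℕ) : ℝ) * π * y) - cos (((n + 1 : ℕ) : ℝ) * π * z)) ^ 2 /
        (((n + 1 : ℕ) : ℝ) * π) ^ 2 ≤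
      4 * (|y - z| / (1 + |y - z| * (n : ℝ)) -
        |y - z| / (1 + |y - z| * ((n + 1 : ℕ) : ℝ))) := by
  have hN : (0 : ℝ) < ((n + 1 : ℕ) : ℝ) := by positivity
  have ha : 0 < ((n + 1 : ℕ) : ℝ) * π := by positivity
  rw [← div_pow, ← sq_abs, abs_div, abs_of_pos ha]
  refine sq_le_telescoping n (by positivity) ?_ ?_
  · rw [div_le_iff₀ ha]
    calc _ ≤ |((n + 1 : ℕ) : ℝ) * π * y - ((n + 1 : ℕ) : ℝ) * π * z| :=
          abs_cos_sub_cos_le _ _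
      _ = _ := by rw [← mul_sub, abs_mul, abs_of_pos ha, mul_comm]
  · rw [div_mul_eq_mul_div, div_le_one ha, mul_comm]
    refine mul_le_mul_of_nonneg_left ?_ hN.le
    have h2 := two_le_pi
    rw [abs_le]
    constructor <;>
      linarith [cos_le_one (((n + 1 : ℕ) : ℝ) * π * y), neg_one_le_cos (((n + 1 : ℕ) : ℝ) * π * y),
        cos_le_one (((n + 1 : ℕ) : ℝ) * π * z), neg_one_le_cos (((n + 1 : ℕ) : ℝ) * π * z)]

theorem stmt_8 (T : ℝ) (hT : 0 < T) :
    ∃ C : ℝ, 0 < C ∧ ∀ t ∈ Set.Icc (0:ℝ) T, ∀ y z : ℝ,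
      Summable (fun α : ℕ+ =>
        2 * (Real.cos ((α : ℝ) * Real.pi * y) - Real.cos ((α : ℝ) * Real.pi * z)) ^ 2
          * (∫ s in (0:ℝ)..t,
              (Real.sin ((α : ℝ) * Real.pi * (t - s))) ^ 2 / ((α : ℝ) * Real.pi) ^ 2)) ∧
      ∑' α : ℕ+,
        2 * (Real.cos ((α : ℝ) * Real.pi * y) - Real.cos ((α : ℝ) * Real.pi * z)) ^ 2
          * (∫ s in (0:ℝ)..t,
              (Real.sin ((α : ℝ) * Real.pi * (t - s))) ^ 2 / ((α : ℝ) * Real.pi) ^ 2)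
        ≤ C * |y - z| := by
  refine ⟨8 * T, by positivity, fun t ht y z => ?_⟩
  set F : ℕ → ℝ := fun k =>
    2 * (cos ((k : ℝ) * π * y) - cos ((k : ℝ) * π * z)) ^ 2
      * (∫ s in (0:ℝ)..t, (sin ((k : ℝ) * π * (t - s))) ^ 2 / ((k : ℝ) * π) ^ 2) with hF
  set g : ℕ → ℝ := fun k => |y - z| / (1 + |y - z| * (k : ℝ)) with hg
  have hnonneg : ∀ n : ℕ, 0 ≤ F (n + 1) := fun n =>
    mul_nonneg (by positivity) (integral_sin_sq_div_sq_nonneg _ t ht.1)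
  have hterm : ∀ n : ℕ, F (n + 1) ≤ 8 * T * (g n - g (n + 1)) := by
    intro n
    have hint := integral_sin_sq_div_sq_le (((n + 1 : ℕ) : ℝ) * π) t ht.1
    have hcos := cos_sub_cos_sq_div_le n y z
    calc F (n + 1)
        ≤ 2 * (cos (((n + 1 : ℕ) : ℝ) * π * y) - cos (((n + 1 : ℕ) : ℝ) * π * z)) ^ 2
            * (T / (((n + 1 : ℕ) : ℝ) * π) ^ 2) := by
          refine mul_le_mul_of_nonneg_left (hint.trans ?_) (by positivity)
          gcongr
          exact ht.2
      _ = 2 * T * ((cos (((n + 1 : ℕ) : ℝ) * π * y) - cos (((n + 1 : ℕ) : ℝ) * π * z)) ^ 2 /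
            (((n + 1 : ℕ) : ℝ) * π) ^ 2) := by ring
      _ ≤ 2 * T * (4 * (g n - g (n + 1))) := mul_le_mul_of_nonneg_left hcos (by positivity)
      _ = _ := by ring
  have hpartial : ∀ N : ℕ, ∑ n ∈ Finset.range N, F (n + 1) ≤ 8 * T * |y - z| := by
    intro N
    calc ∑ n ∈ Finset.range N, F (n + 1)
        ≤ ∑ n ∈ Finset.range N, 8 * T * (g n - g (n + 1)) :=
          Finset.sum_le_sum fun n _ => hterm n
      _ = 8 * T * (g 0 - g N) := by rw [← Finset.mul_sum, Finset.sum_range_sub']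
      _ ≤ 8 * T * |y - z| := by
          have h0 : g 0 = |y - z| := by simp [hg]
          have hN : 0 ≤ g N := by positivity
          gcongr
          linarith
  constructor
  · exact (summable_pnat_iff_summable_succ (f := F)).2
      (summable_of_sum_range_le hnonneg hpartial)
  · exact (tsum_pnat_eq_tsum_succ (f := F)).trans_le
      (Real.tsum_le_of_sum_range_le hnonneg hpartial)
end
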